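/- Let e ≥ 10 be an integer and n = e−2. The defining toric ideal I_{S(e,1,e−2)} of the numerical semigroup S(e,1,e−2) inside R(e,1,e−2) = K[x_0, x_2, x_3, …, x_{e−3}, x_{e−1}] is generated, minimally, by the set G = J ∪ K ∪ L, where J = {x_i x_{j+1} − x_{i+1} x_j : 2 ≤ i < j ≤ e−4} ∪ {x_0^2 x_i − x_{i+1} x_{e−1} : 2 ≤ i ≤ e−4}, K = {x_0 x_{i+2} − x_2 x_i : i ∈ {2,…,e−3} \ {e−4}}, and L = {x_{e−3} x_{e−3−i} − x_{e−1} x_{e−5−i} : 0 ≤ i ≤ e−7} ∪ {x_0^3 − x_3 x_{e−3}, x_0 x_2 x_{e−4} − x_{e−1}^2}. -/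

import Mathlib

open MvPolynomial

/-- Index set of the polynomial ring `R(e,m,n)`: indices `i ∈ {0,…,e−1} \ {m,n}`. -/
abbrev SallyIdx (e m n : ℕ) : Type := {i : ℕ // i < e ∧ i ≠ m ∧ i ≠ n}

/-- The variable `x_i` of `R(e,m,n)` (and `0` for an invalid index). -/
noncomputable def sX (e m n : ℕ) (i : ℕ) : MvPolynomial (SallyIdx e m n) ℚ :=
  if h : i < e ∧ i ≠ m ∧ i ≠ n then MvPolynomial.X ⟨i, h⟩ else 0

/-- The defining toric ideal `I_{S(e,m,n)}`: the kernel of the `ℚ`-algebra homomorphism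
`R(e,m,n) → ℚ[t]` sending `x_i ↦ t^{e+i}`. -/
noncomputable def sallyIdeal (e m n : ℕ) : Ideal (MvPolynomial (SallyIdx e m n) ℚ) :=
  RingHom.ker (MvPolynomial.aeval
    (fun i : SallyIdx e m n => (Polynomial.X : Polynomial ℚ) ^ (e + i.1))).toRingHom

/-- The generating set `G = J ∪ K ∪ L` for `I_{S(e,1,e−2)}`. -/
noncomputable def genSet (e : ℕ) : Set (MvPolynomial (SallyIdx e 1 (e-2)) ℚ) :=
  -- J
  {p | ∃ i j : ℕ, 2 ≤ i ∧ i < j ∧ j ≤ e - 4 ∧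
      p = sX e 1 (e-2) i * sX e 1 (e-2) (j+1) - sX e 1 (e-2) (i+1) * sX e 1 (e-2) j} ∪
  {p | ∃ i : ℕ, 2 ≤ i ∧ i ≤ e - 4 ∧
      p = sX e 1 (e-2) 0 ^ 2 * sX e 1 (e-2) i - sX e 1 (e-2) (i+1) * sX e 1 (e-2) (e-1)} ∪
  -- K
  {p | ∃ i : ℕ, (2 ≤ i ∧ i ≤ e - 3 ∧ i ≠ e - 4) ∧
      p = sX e 1 (e-2) 0 * sX e 1 (e-2) (i+2) - sX e 1 (e-2) 2 * sX e 1 (e-2) i} ∪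
  -- L
  {p | ∃ i : ℕ, i ≤ e - 7 ∧
      p = sX e 1 (e-2) (e-3) * sX e 1 (e-2) (e-3-i) -
          sX e 1 (e-2) (e-1) * sX e 1 (e-2) (e-5-i)} ∪
  {sX e 1 (e-2) 0 ^ 3 - sX e 1 (e-2) 3 * sX e 1 (e-2) (e-3),
   sX e 1 (e-2) 0 * sX e 1 (e-2) 2 * sX e 1 (e-2) (e-4) - sX e 1 (e-2) (e-1) ^ 2}

section NormalForm

variable {A : Type*} [CommRing A]

/-- The relations that the generators of `I_{S(e,1,e-2)}` impose on the images `y i` of the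
variables. -/
structure SallyRelations (e : ℕ) (y : ℕ → A) : Prop where
  minor : ∀ i j, 2 ≤ i → i < j → j ≤ e - 4 → y i * y (j + 1) = y (i + 1) * y j
  last_mul : ∀ i, 2 ≤ i → i ≤ e - 4 → y 0 ^ 2 * y i = y (i + 1) * y (e - 1)
  zero_mul : ∀ i, 2 ≤ i → i ≤ e - 3 → i ≠ e - 4 → y 0 * y (i + 2) = y 2 * y i
  top_mul : ∀ i, i ≤ e - 7 → y (e - 3) * y (e - 3 - i) = y (e - 1) * y (e - 5 - i)
  zero_cube : y 0 ^ 3 = y 3 * y (e - 3)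
  last_sq : y 0 * y 2 * y (e - 4) = y (e - 1) ^ 2

/-- `q` is a power of `y 0` times the representative of an Apéry element, of total degree `d`. -/
def IsSallyReduced (e : ℕ) (y : ℕ → A) (d : ℕ) (q : A) : Prop :=
  ∃ k, (d = e * k ∧ q = y 0 ^ k) ∨
    (∃ i, 2 ≤ i ∧ i < e ∧ i ≠ e - 2 ∧ d = e * k + (e + i) ∧ q = y 0 ^ k * y i) ∨
    (d = e * k + (3 * e + 1) ∧ q = y 0 ^ k * (y 2 * y (e - 1))) ∨
    (d = e * k + (3 * e - 2) ∧ q = y 0 ^ k * (y 2 * y (e - 4)))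

/-- The only possible reduced element of degree `d`. -/
def sallyNormalForm (e : ℕ) (y : ℕ → A) (d : ℕ) : A :=
  if d % e = 0 then y 0 ^ (d / e)
  else if d % e = 1 then y 0 ^ (d / e - 3) * (y 2 * y (e - 1))
  else if d % e = e - 2 then y 0 ^ (d / e - 2) * (y 2 * y (e - 4))
  else y 0 ^ (d / e - 1) * y (d % e)

theorem IsSallyReduced.eq_sallyNormalForm {e : ℕ} (he : 10 ≤ e) {y : ℕ → A} {d : ℕ} {q : A}
    (h : IsSallyReduced e y d q) : q = sallyNormalForm e y d := by
  have key : ∀ k r, r < e → (e * k + r) / e = k ∧ (e * k + r) % e = r := fun k r hr => by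
    constructor
    · rw [Nat.mul_add_div (by omega), Nat.div_eq_of_lt hr, add_zero]
    · rw [Nat.mul_add_mod, Nat.mod_eq_of_lt hr]
  obtain ⟨k, ⟨rfl, rfl⟩ | ⟨i, h1, h2, h3, rfl, rfl⟩ | ⟨rfl, rfl⟩ | ⟨rfl, rfl⟩⟩ := h
  · obtain ⟨h1, h2⟩ := key k 0 (by omega)
    rw [add_zero] at h1 h2
    simp [sallyNormalForm, h1, h2]
  · have hd : e * k + (e + i) = e * (k + 1) + i := by ring
    obtain ⟨h4, h5⟩ := key (k + 1) i h2
    rw [hd, sallyNormalForm, h4, h5, if_neg (by omega), if_neg (by omega), if_neg h3,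
      Nat.add_sub_cancel]
  · have hd : e * k + (3 * e + 1) = e * (k + 3) + 1 := by ring
    obtain ⟨h4, h5⟩ := key (k + 3) 1 (by omega)
    rw [hd, sallyNormalForm, h4, h5, if_neg (by omega), if_pos rfl, Nat.add_sub_cancel]
  · have hd : e * k + (3 * e - 2) = e * (k + 2) + (e - 2) := by
      rw [mul_add]; omega
    obtain ⟨h4, h5⟩ := key (k + 2) (e - 2) (by omega)
    rw [hd, sallyNormalForm, h4, h5, if_neg (by omega), if_neg (by omega), if_pos rfl,
      Nat.add_sub_cancel]

theorem IsSallyReduced.pow_mul {e : ℕ} {y : ℕ → A} {d : ℕ} {q : A} (h : IsSallyReduced e y d q) (l : ℕ) :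
    IsSallyReduced e y (e * l + d) (y 0 ^ l * q) := by
  obtain ⟨k, ⟨rfl, rfl⟩ | ⟨i, h1, h2, h3, rfl, rfl⟩ | ⟨rfl, rfl⟩ | ⟨rfl, rfl⟩⟩ := h
  · exact ⟨l + k, Or.inl ⟨by ring, by ring⟩⟩
  · exact ⟨l + k, Or.inr (Or.inl ⟨i, h1, h2, h3, by ring, by ring⟩)⟩
  · exact ⟨l + k, Or.inr (Or.inr (Or.inl ⟨by ring, by ring⟩))⟩
  · exact ⟨l + k, Or.inr (Or.inr (Or.inr ⟨by rw [mul_add]; omega, by ring⟩))⟩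

theorem isReduced_pow {e : ℕ} {y : ℕ → A} {d : ℕ} {q : A} (k : ℕ) (hd : d = e * k)
    (hq : q = y 0 ^ k) : IsSallyReduced e y d q :=
  ⟨k, Or.inl ⟨hd, hq⟩⟩

theorem isReduced_pow_mul_var {e : ℕ} {y : ℕ → A} {d : ℕ} {q : A} (k i : ℕ) (h2 : 2 ≤ i)
    (hi : i < e) (hi' : i ≠ e - 2) (hd : d = e * k + (e + i)) (hq : q = y 0 ^ k * y i) :
    IsSallyReduced e y d q :=
  ⟨k, Or.inr (Or.inl ⟨i, h2, hi, hi', hd, hq⟩)⟩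

theorem isReduced_pow_mul_last {e : ℕ} {y : ℕ → A} {d : ℕ} {q : A} (k : ℕ)
    (hd : d = e * k + (3 * e + 1)) (hq : q = y 0 ^ k * (y 2 * y (e - 1))) : IsSallyReduced e y d q :=
  ⟨k, Or.inr (Or.inr (Or.inl ⟨hd, hq⟩))⟩

theorem isReduced_pow_mul_mid {e : ℕ} {y : ℕ → A} {d : ℕ} {q : A} (k : ℕ)
    (hd : d = e * k + (3 * e - 2)) (hq : q = y 0 ^ k * (y 2 * y (e - 4))) : IsSallyReduced e y d q :=
  ⟨k, Or.inr (Or.inr (Or.inr ⟨hd, hq⟩))⟩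

namespace SallyRelations

variable {e : ℕ} {y : ℕ → A}

theorem minor_of_le (h : SallyRelations e y) {i j : ℕ} (hi : 2 ≤ i) (hj : 2 ≤ j)
    (hi' : i ≤ e - 4) (hj' : j ≤ e - 4) : y i * y (j + 1) = y (i + 1) * y j := by
  rcases lt_trichotomy i j with hlt | rfl | hlt
  · exact h.minor i j hi hlt hj'
  · ring
  · linear_combination -h.minor j i hj hlt hi'

theorem slide (h : SallyRelations e y) (t : ℕ) : ∀ {a b : ℕ}, 2 ≤ a → 2 ≤ b → a + t ≤ e - 3 →
    b + t ≤ e - 3 → y a * y (b + t) = y (a + t) * y b := by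
  induction t with
  | zero => intros; rfl
  | succ t ih =>
    intro a b ha hb hat hbt
    have h1 := h.minor_of_le (i := a) (j := b + t) ha (by omega) (by omega) (by omega)
    have h2 := ih (a := a + 1) (b := b) (by omega) hb (by omega) (by omega)
    rw [show b + (t + 1) = b + t + 1 by ring, h1, h2, show a + 1 + t = a + (t + 1) by ring]

theorem mul_eq_mul (h : SallyRelations e y) {a b c d : ℕ} (ha : 2 ≤ a) (hb : 2 ≤ b) (hc : 2 ≤ c)
    (hd : 2 ≤ d) (ha' : a ≤ e - 3) (hb' : b ≤ e - 3) (hc' : c ≤ e - 3) (hd' : d ≤ e - 3)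
    (hs : a + b = c + d) : y a * y b = y c * y d := by
  rcases le_total a c with hac | hac
  · have := h.slide (c - a) ha hd (by omega) (by omega)
    rwa [show d + (c - a) = b by omega, show a + (c - a) = c by omega] at this
  · have := h.slide (a - c) hc hb (by omega) (by omega)
    rw [show b + (a - c) = d by omega, show c + (a - c) = a by omega] at this
    exact this.symm

theorem mul_eq_zero_mul (h : SallyRelations e y) {a b s : ℕ} (ha : 2 ≤ a) (hb : 2 ≤ b)
    (hs : a + b = s) (hse : s < e) (hs' : s ≠ e - 2) : y a * y b = y 0 * y s := by
  have h1 := h.zero_mul (s - 2) (by omega) (by omega) (by omega)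
  rw [show s - 2 + 2 = s by omega] at h1
  rw [h1]
  by_cases hab : a ≤ e - 3 ∧ b ≤ e - 3
  · exact h.mul_eq_mul ha hb le_rfl (by omega) hab.1 hab.2 (by omega) (by omega) (by omega)
  · omega

theorem mul_eq_zero_cube (he : 10 ≤ e) (h : SallyRelations e y) {a b : ℕ} (ha : 2 ≤ a)
    (hb : 2 ≤ b) (ha' : a ≤ e - 3) (hb' : b ≤ e - 3) (hs : a + b = e) :
    y a * y b = y 0 ^ 3 := by
  rw [h.zero_cube]
  exact h.mul_eq_mul ha hb (by omega) (by omega) ha' hb' (by omega) (by omega) (by omega)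

theorem mul_eq_last_mul (h : SallyRelations e y) {a b u : ℕ} (ha' : a ≤ e - 3)
    (hb' : b ≤ e - 3) (hu : 2 ≤ u) (hs : a + b + 1 = e + u) : y a * y b = y u * y (e - 1) := by
  have h1 := h.top_mul (e - 5 - u) (by omega)
  rw [show e - 3 - (e - 5 - u) = u + 2 by omega, show e - 5 - (e - 5 - u) = u by omega] at h1
  rw [mul_comm (y u), ← h1]
  exact h.mul_eq_mul (by omega) (by omega) (by omega) (by omega) ha' hb' (by omega) (by omega)
    (by omega)

theorem mul_last (h : SallyRelations e y) {u : ℕ} (hu : 3 ≤ u) (hu' : u ≤ e - 3) :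
    y u * y (e - 1) = y 0 ^ 2 * y (u - 1) := by
  have := h.last_mul (u - 1) (by omega) (by omega)
  rw [show u - 1 + 1 = u by omega] at this
  exact this.symm

theorem isReduced_mul_last (h : SallyRelations e y) {u : ℕ} (hu : 2 ≤ u)
    (hu' : u ≤ e - 3) : IsSallyReduced e y (e + u + (2 * e - 1)) (y u * y (e - 1)) := by
  rcases eq_or_lt_of_le hu with rfl | hu3
  · exact isReduced_pow_mul_last 0 (by omega) (by ring)
  · exact isReduced_pow_mul_var 2 (u - 1) (by omega) (by omega) (by omega) (by omega)
      (h.mul_last hu3 hu')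

theorem isReduced_mul (he : 10 ≤ e) (h : SallyRelations e y) {a b : ℕ} (ha : 2 ≤ a) (hb : 2 ≤ b)
    (hae : a < e) (hbe : b < e) (ha' : a ≠ e - 2) (hb' : b ≠ e - 2) :
    IsSallyReduced e y (e + a + (e + b)) (y a * y b) := by
  by_cases ha1 : a = e - 1
  · subst ha1
    by_cases hb1 : b = e - 1
    · subst hb1
      exact isReduced_pow_mul_mid 1 (by omega) (by linear_combination -h.last_sq)
    · rw [mul_comm, show e + (e - 1) + (e + b) = e + b + (2 * e - 1) by omega]
      exact h.isReduced_mul_last hb (by omega)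
  by_cases hb1 : b = e - 1
  · subst hb1
    rw [show e + a + (e + (e - 1)) = e + a + (2 * e - 1) by omega]
    exact h.isReduced_mul_last ha (by omega)
  by_cases h1 : a + b = e - 2
  · refine isReduced_pow_mul_mid 0 (by omega) ?_
    rw [pow_zero, one_mul]
    exact h.mul_eq_mul ha hb (by omega) (by omega) (by omega) (by omega) (by omega) (by omega)
      (by omega)
  by_cases h2 : a + b < e
  · refine isReduced_pow_mul_var 1 (a + b) (by omega) h2 h1 (by omega) ?_
    rw [pow_one]
    exact h.mul_eq_zero_mul ha hb rfl h2 h1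
  by_cases h3 : a + b = e
  · exact isReduced_pow 3 (by omega)
      (h.mul_eq_zero_cube he ha hb (by omega) (by omega) h3)
  rw [h.mul_eq_last_mul (u := a + b + 1 - e) (by omega) (by omega) (by omega) (by omega),
    show e + a + (e + b) = e + (a + b + 1 - e) + (2 * e - 1) by omega]
  exact h.isReduced_mul_last (by omega) (by omega)

theorem isReduced_two_mul_last_mul (he : 10 ≤ e) (h : SallyRelations e y) {b : ℕ} (hb : 2 ≤ b)
    (hbe : b < e) (hb' : b ≠ e - 2) :
    IsSallyReduced e y (3 * e + 1 + (e + b)) (y 2 * y (e - 1) * y b) := by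
  have h22 : y 2 * y 2 = y 0 * y 4 :=
    h.mul_eq_zero_mul le_rfl le_rfl rfl (by omega) (by omega)
  rcases eq_or_lt_of_le hb with rfl | hb3
  · have h1 := h.mul_last (u := 4) (by omega) (by omega)
    exact isReduced_pow_mul_var 3 3 (by omega) (by omega) (by omega) (by omega)
      (by linear_combination y (e - 1) * h22 + y 0 * h1)
  by_cases hb1 : b = e - 1
  · subst hb1
    have h1 := h.mul_eq_zero_cube he (a := 4) (b := e - 4) (by omega) (by omega) (by omega)
      (by omega) (by omega)
    exact isReduced_pow 5 (by omega)
      (by linear_combination -y 2 * h.last_sq + y 0 * y (e - 4) * h22 + y 0 ^ 2 * h1)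
  have h1 := (h.isReduced_mul he (a := 2) (b := b - 1) le_rfl (by omega) (by omega) (by omega)
    (by omega) (by omega)).pow_mul 2
  rw [show y 2 * y (e - 1) * y b = y 0 ^ 2 * (y 2 * y (b - 1)) by
      linear_combination y 2 * h.mul_last (u := b) (by omega) (by omega),
    show 3 * e + 1 + (e + b) = e * 2 + (e + 2 + (e + (b - 1))) by omega]
  exact h1

theorem isReduced_two_mul_mid_mul (he : 10 ≤ e) (h : SallyRelations e y) {b : ℕ} (hb : 2 ≤ b)
    (hbe : b < e) (hb' : b ≠ e - 2) :
    IsSallyReduced e y (3 * e - 2 + (e + b)) (y 2 * y (e - 4) * y b) := by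
  have h22 : y 2 * y 2 = y 0 * y 4 :=
    h.mul_eq_zero_mul le_rfl le_rfl rfl (by omega) (by omega)
  have h4 := h.mul_eq_zero_cube he (a := 4) (b := e - 4) (by omega) (by omega) (by omega)
    (by omega) (by omega)
  by_cases b2 : b = 2
  · subst b2
    exact isReduced_pow 4 (by omega) (by linear_combination y (e - 4) * h22 + y 0 * h4)
  by_cases b3 : b = 3
  · subst b3
    have h1 := h.mul_eq_zero_mul (a := e - 4) (b := 3) (s := e - 1) (by omega) (by omega)
      (by omega) (by omega) (by omega)
    exact isReduced_pow_mul_last 1 (by omega) (by linear_combination y 2 * h1)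
  by_cases b4 : b = 4
  · subst b4
    exact isReduced_pow_mul_var 3 2 (by omega) (by omega) (by omega) (by omega)
      (by linear_combination y 2 * h4)
  by_cases be : b = e - 1
  · subst be
    have h1 := h.mul_last (u := e - 4) (by omega) (by omega)
    have h2 := h.mul_eq_zero_mul (a := 2) (b := e - 4 - 1) (s := e - 3) (by omega) (by omega)
      (by omega) (by omega) (by omega)
    exact isReduced_pow_mul_var 3 (e - 3) (by omega) (by omega) (by omega) (by omega)
      (by linear_combination y 2 * h1 + y 0 ^ 2 * h2)
  have h1 := h.mul_eq_last_mul (a := e - 4) (b := b) (u := b - 3) (by omega) (by omega) (by omega)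
    (by omega)
  rw [show y 2 * y (e - 4) * y b = y 2 * y (e - 1) * y (b - 3) by linear_combination y 2 * h1,
    show 3 * e - 2 + (e + b) = 3 * e + 1 + (e + (b - 3)) by omega]
  exact h.isReduced_two_mul_last_mul he (by omega) (by omega) (by omega)

theorem isReduced_mul_var (he : 10 ≤ e) (h : SallyRelations e y) {d b : ℕ} {q : A}
    (hq : IsSallyReduced e y d q) (hbe : b < e) (hb1 : b ≠ 1) (hb' : b ≠ e - 2) :
    IsSallyReduced e y (d + (e + b)) (q * y b) := by
  rcases Nat.eq_zero_or_pos b with rfl | hb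
  · have := hq.pow_mul 1
    rwa [pow_one, mul_one, mul_comm (y 0), add_comm e d] at this
  have hb : 2 ≤ b := by omega
  obtain ⟨k, ⟨rfl, rfl⟩ | ⟨i, h1, h2, h3, rfl, rfl⟩ | ⟨rfl, rfl⟩ | ⟨rfl, rfl⟩⟩ := hq
  · exact isReduced_pow_mul_var k b hb hbe hb' rfl rfl
  · rw [add_assoc, mul_assoc]
    exact (h.isReduced_mul he h1 hb h2 hbe h3 hb').pow_mul k
  · rw [add_assoc, mul_assoc]
    exact (h.isReduced_two_mul_last_mul he hb hbe hb').pow_mul k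
  · rw [add_assoc, mul_assoc]
    exact (h.isReduced_two_mul_mid_mul he hb hbe hb').pow_mul k

end SallyRelations

end NormalForm

theorem sX_of_valid {e m n i : ℕ} (h : i < e ∧ i ≠ m ∧ i ≠ n) : sX e m n i = X ⟨i, h⟩ :=
  dif_pos h

theorem mem_sallyIdeal {e m n : ℕ} {p : MvPolynomial (SallyIdx e m n) ℚ} :
    p ∈ sallyIdeal e m n ↔
      aeval (fun i : SallyIdx e m n => (Polynomial.X : Polynomial ℚ) ^ (e + i.1)) p = 0 :=
  Iff.rfl

theorem genSet_subset_sallyIdeal {e : ℕ} (he : 10 ≤ e) :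
    genSet e ⊆ sallyIdeal e 1 (e - 2) := by
  have hX : ∀ i, i < e ∧ i ≠ 1 ∧ i ≠ e - 2 →
      aeval (fun i : SallyIdx e 1 (e - 2) => (Polynomial.X : Polynomial ℚ) ^ (e + i.1))
        (sX e 1 (e - 2) i) = Polynomial.X ^ (e + i) := fun i hi => by
    rw [sX_of_valid hi, aeval_X]
  rintro p ((((⟨i, j, h1, h2, h3, rfl⟩ | ⟨i, h1, h2, rfl⟩) | ⟨i, ⟨h1, h2, h3⟩, rfl⟩) |
    ⟨i, h1, rfl⟩) | rfl | rfl) <;>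
  · rw [SetLike.mem_coe, mem_sallyIdeal, map_sub, sub_eq_zero]
    simp only [map_mul, map_pow]
    repeat rw [hX _ (by omega)]
    simp only [← pow_mul, ← pow_add]
    congr 1
    omega

theorem sallyRelations_mk {e : ℕ} :
    SallyRelations e
      (fun i => Ideal.Quotient.mk (Ideal.span (genSet e)) (sX e 1 (e - 2) i)) := by
  have key : ∀ {p q}, p - q ∈ genSet e → Ideal.Quotient.mk (Ideal.span (genSet e)) p =
      Ideal.Quotient.mk (Ideal.span (genSet e)) q := fun h =>
    Ideal.Quotient.eq.mpr (Ideal.subset_span h)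
  constructor <;> intros <;> simp only [← map_mul, ← map_pow] <;> apply key
  · exact Or.inl (Or.inl (Or.inl (Or.inl ⟨_, _, ‹_›, ‹_›, ‹_›, rfl⟩)))
  · exact Or.inl (Or.inl (Or.inl (Or.inr ⟨_, ‹_›, ‹_›, rfl⟩)))
  · exact Or.inl (Or.inl (Or.inr ⟨_, ⟨‹_›, ‹_›, ‹_›⟩, rfl⟩))
  · exact Or.inl (Or.inr ⟨_, ‹_›, rfl⟩)
  · exact Or.inr (Or.inl rfl)
  · exact Or.inr (Or.inr rfl)

theorem sallyIdeal_le_span_genSet {e : ℕ} (he : 10 ≤ e) :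
    sallyIdeal e 1 (e - 2) ≤ Ideal.span (genSet e) := by
  let mk := Ideal.Quotient.mkₐ ℚ (Ideal.span (genSet e))
  set y := fun i => mk (sX e 1 (e - 2) i) with hy
  set φ := aeval (R := ℚ)
    (fun i : SallyIdx e 1 (e - 2) => (Polynomial.X : Polynomial ℚ) ^ (e + i.1)) with hφ
  have hrel : SallyRelations e y := sallyRelations_mk
  have hmon : ∀ (u : SallyIdx e 1 (e - 2) →₀ ℕ) (a : ℚ), ∃ (c : ℚ) (d : ℕ) (q : _), φ (monomial u a) =
      c • Polynomial.X ^ d ∧ mk (monomial u a) = c • q ∧ IsSallyReduced e y d q := by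
    refine induction_on_monomial (motive := fun p => ∃ (c : ℚ) (d : ℕ) (q : _),
      φ p = c • Polynomial.X ^ d ∧ mk p = c • q ∧ IsSallyReduced e y d q) (fun a => ?_) ?_
    · refine ⟨a, 0, 1, ?_, ?_, isReduced_pow 0 rfl (pow_zero _).symm⟩
      · rw [← algebraMap_eq, AlgHom.commutes, pow_zero, Algebra.algebraMap_eq_smul_one]
      · rw [← algebraMap_eq, AlgHom.commutes, Algebra.algebraMap_eq_smul_one]
    · rintro p i ⟨c, d, q, h1, h2, h3⟩
      refine ⟨c, d + (e + i.1), q * y i.1, ?_, ?_,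
        hrel.isReduced_mul_var he h3 i.2.1 i.2.2.1 i.2.2.2⟩
      · rw [map_mul, h1, hφ, aeval_X, pow_add _ d, smul_mul_assoc]
      · rw [map_mul, h2, smul_mul_assoc, hy]
        simp only [sX_of_valid i.2]
  let L : Polynomial ℚ →ₗ[ℚ] _ := (Polynomial.basisMonomials ℚ).constr ℚ (sallyNormalForm e y)
  have hL : ∀ d, L (Polynomial.X ^ d) = sallyNormalForm e y d := fun d => by
    have := (Polynomial.basisMonomials ℚ).constr_basis ℚ (sallyNormalForm e y) d
    rw [Polynomial.coe_basisMonomials] at this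
    rwa [← Polynomial.monomial_one_right_eq_X_pow]
  have hcomp : L ∘ₗ φ.toLinearMap = mk.toLinearMap := by
    refine (basisMonomials _ ℚ).ext fun u => ?_
    obtain ⟨c, d, q, hd, hq, hred⟩ := hmon u 1
    rw [coe_basisMonomials, LinearMap.comp_apply, AlgHom.toLinearMap_apply,
      AlgHom.toLinearMap_apply, hd, hq, map_smul, hL, hred.eq_sallyNormalForm he]
  intro p hp
  have := LinearMap.congr_fun hcomp p
  rw [LinearMap.comp_apply, AlgHom.toLinearMap_apply, mem_sallyIdeal.mp hp, map_zero] at this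
  exact Ideal.Quotient.eq_zero_iff_mem.mp this.symm

/-- The homomorphism sending `x_a` to `t * v ^ a` when `lo ≤ a ≤ hi` and to `0` otherwise. -/
noncomputable def windowHom (e m n lo hi : ℕ) :
    MvPolynomial (SallyIdx e m n) ℚ →ₐ[ℚ] Polynomial (Polynomial ℚ) :=
  aeval fun a => if lo ≤ a.1 ∧ a.1 ≤ hi then Polynomial.X * Polynomial.C (Polynomial.X ^ a.1) else 0

/-- The sum of the coefficients at the monomials `x_a x_b` with `a + b = s` and
`lo ≤ a, b ≤ hi`. -/
noncomputable def windowCoeff (e m n lo hi s : ℕ) (p : MvPolynomial (SallyIdx e m n) ℚ) : ℚ :=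
  ((windowHom e m n lo hi p).coeff 2).coeff s

section Window

variable {e m n : ℕ} (lo hi s : ℕ)

theorem coeff_zero_windowHom (f : MvPolynomial (SallyIdx e m n) ℚ) :
    (windowHom e m n lo hi f).coeff 0 = Polynomial.C (constantCoeff f) := by
  induction f using MvPolynomial.induction_on with
  | C a => simp [windowHom, Polynomial.algebraMap_apply]
  | add p q hp hq => simp [hp, hq]
  | mul_X p i hp =>
    simp only [windowHom, map_mul, aeval_X, constantCoeff_X, mul_zero, map_zero] at *
    rw [Polynomial.mul_coeff_zero]
    split_ifs <;> simp

theorem windowHom_sX {a : ℕ} (ha : a < e ∧ a ≠ m ∧ a ≠ n) :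
    windowHom e m n lo hi (sX e m n a) = Polynomial.X *
      Polynomial.C (if lo ≤ a ∧ a ≤ hi then Polynomial.X ^ a else 0) := by
  rw [sX_of_valid ha, windowHom, aeval_X]
  split_ifs <;> simp

theorem windowCoeff_sub (p q : MvPolynomial (SallyIdx e m n) ℚ) :
    windowCoeff e m n lo hi s (p - q) =
      windowCoeff e m n lo hi s p - windowCoeff e m n lo hi s q := by
  simp [windowCoeff]

theorem windowCoeff_add (p q : MvPolynomial (SallyIdx e m n) ℚ) :
    windowCoeff e m n lo hi s (p + q) =
      windowCoeff e m n lo hi s p + windowCoeff e m n lo hi s q := by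
  simp [windowCoeff]

theorem windowCoeff_mul_quadratic (f : MvPolynomial (SallyIdx e m n) ℚ) {a b : ℕ}
    (ha : a < e ∧ a ≠ m ∧ a ≠ n) (hb : b < e ∧ b ≠ m ∧ b ≠ n) :
    windowCoeff e m n lo hi s (f * (sX e m n a * sX e m n b)) = constantCoeff f *
      if (lo ≤ a ∧ a ≤ hi) ∧ (lo ≤ b ∧ b ≤ hi) ∧ a + b = s then 1 else 0 := by
  have h : ∀ (F : Polynomial (Polynomial ℚ)) (u v : Polynomial ℚ),
      (F * (Polynomial.X * Polynomial.C u * (Polynomial.X * Polynomial.C v))).coeff 2 =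
        F.coeff 0 * (u * v) := fun F u v => by
    rw [show F * (Polynomial.X * Polynomial.C u * (Polynomial.X * Polynomial.C v)) =
      F * Polynomial.C (u * v) * Polynomial.X ^ 2 by rw [Polynomial.C_mul]; ring]
    rw [Polynomial.coeff_mul_X_pow', if_pos le_rfl, Nat.sub_self, Polynomial.coeff_mul_C]
  rw [windowCoeff, map_mul, map_mul, windowHom_sX lo hi ha, windowHom_sX lo hi hb, h,
    coeff_zero_windowHom, Polynomial.coeff_C_mul]
  congr 1
  by_cases h1 : lo ≤ a ∧ a ≤ hi <;> by_cases h2 : lo ≤ b ∧ b ≤ hi <;>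
    simp [h1, h2, ← pow_add, Polynomial.coeff_X_pow, eq_comm]

theorem windowCoeff_mul_cubic (f : MvPolynomial (SallyIdx e m n) ℚ) {a b c : ℕ}
    (ha : a < e ∧ a ≠ m ∧ a ≠ n) (hb : b < e ∧ b ≠ m ∧ b ≠ n) (hc : c < e ∧ c ≠ m ∧ c ≠ n) :
    windowCoeff e m n lo hi s (f * (sX e m n a * sX e m n b * sX e m n c)) = 0 := by
  rw [show f * (sX e m n a * sX e m n b * sX e m n c) =
    f * sX e m n a * (sX e m n b * sX e m n c) by ring, windowCoeff_mul_quadratic lo hi s _ hb hc,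
    map_mul, sX_of_valid ha, constantCoeff_X, mul_zero, zero_mul]

theorem windowCoeff_eq_zero_of_mem_span {H : Set (MvPolynomial (SallyIdx e m n) ℚ)}
    (hH : ∀ h ∈ H, ∀ f, windowCoeff e m n lo hi s (f * h) = 0) {p} (hp : p ∈ Ideal.span H) :
    windowCoeff e m n lo hi s p = 0 := by
  suffices ∀ f, windowCoeff e m n lo hi s (f * p) = 0 by simpa using this 1
  induction hp using Submodule.span_induction with
  | mem x hx => exact hH x hx
  | zero => intro f; simp [windowCoeff]
  | add x y _ _ hx hy =>
    intro f
    rw [mul_add, windowCoeff_add, hx, hy, add_zero]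
  | smul r x _ hx =>
    intro f
    rw [smul_eq_mul, ← mul_assoc]
    exact hx (f * r)

theorem windowCoeff_mul_quadratic_sub_eq_zero {a b c d : ℕ}
    (ha : a < e ∧ a ≠ m ∧ a ≠ n) (hb : b < e ∧ b ≠ m ∧ b ≠ n)
    (hc : c < e ∧ c ≠ m ∧ c ≠ n) (hd : d < e ∧ d ≠ m ∧ d ≠ n)
    (h : (lo ≤ a ∧ a ≤ hi) ∧ (lo ≤ b ∧ b ≤ hi) ∧ a + b = s ↔
      (lo ≤ c ∧ c ≤ hi) ∧ (lo ≤ d ∧ d ≤ hi) ∧ c + d = s) (f : MvPolynomial (SallyIdx e m n) ℚ) :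
    windowCoeff e m n lo hi s
      (f * (sX e m n a * sX e m n b - sX e m n c * sX e m n d)) = 0 := by
  rw [mul_sub, windowCoeff_sub, windowCoeff_mul_quadratic lo hi s f ha hb,
    windowCoeff_mul_quadratic lo hi s f hc hd]
  simp only [h, sub_self]

theorem windowCoeff_quadratic_sub_ne_zero {a b c d : ℕ}
    (ha : a < e ∧ a ≠ m ∧ a ≠ n) (hb : b < e ∧ b ≠ m ∧ b ≠ n)
    (hc : c < e ∧ c ≠ m ∧ c ≠ n) (hd : d < e ∧ d ≠ m ∧ d ≠ n)
    (h : ¬((lo ≤ a ∧ a ≤ hi) ∧ (lo ≤ b ∧ b ≤ hi) ∧ a + b = s ↔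
      (lo ≤ c ∧ c ≤ hi) ∧ (lo ≤ d ∧ d ≤ hi) ∧ c + d = s)) :
    windowCoeff e m n lo hi s (sX e m n a * sX e m n b - sX e m n c * sX e m n d) ≠ 0 := by
  rw [← one_mul (_ - _), mul_sub, windowCoeff_sub, windowCoeff_mul_quadratic lo hi s 1 ha hb,
    windowCoeff_mul_quadratic lo hi s 1 hc hd]
  split_ifs with hp hq hq
  · exact absurd (iff_of_true hp hq) h
  · simp
  · simp
  · exact absurd (iff_of_false hp hq) h

theorem windowCoeff_mul_cubic_sub_eq_zero {a b c d k : ℕ}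
    (ha : a < e ∧ a ≠ m ∧ a ≠ n) (hb : b < e ∧ b ≠ m ∧ b ≠ n) (hk : k < e ∧ k ≠ m ∧ k ≠ n)
    (hc : c < e ∧ c ≠ m ∧ c ≠ n) (hd : d < e ∧ d ≠ m ∧ d ≠ n)
    (h : ¬((lo ≤ c ∧ c ≤ hi) ∧ (lo ≤ d ∧ d ≤ hi) ∧ c + d = s))
    (f : MvPolynomial (SallyIdx e m n) ℚ) :
    windowCoeff e m n lo hi s
      (f * (sX e m n a * sX e m n b * sX e m n k - sX e m n c * sX e m n d)) = 0 := by
  rw [mul_sub, windowCoeff_sub, windowCoeff_mul_cubic lo hi s f ha hb hk,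
    windowCoeff_mul_quadratic lo hi s f hc hd, if_neg h, mul_zero, sub_zero]

theorem windowCoeff_cubic_sub_ne_zero {a b c d k : ℕ}
    (ha : a < e ∧ a ≠ m ∧ a ≠ n) (hb : b < e ∧ b ≠ m ∧ b ≠ n) (hk : k < e ∧ k ≠ m ∧ k ≠ n)
    (hc : c < e ∧ c ≠ m ∧ c ≠ n) (hd : d < e ∧ d ≠ m ∧ d ≠ n)
    (h : (lo ≤ c ∧ c ≤ hi) ∧ (lo ≤ d ∧ d ≤ hi) ∧ c + d = s) :
    windowCoeff e m n lo hi s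
      (sX e m n a * sX e m n b * sX e m n k - sX e m n c * sX e m n d) ≠ 0 := by
  rw [← one_mul (_ - _), mul_sub, windowCoeff_sub, windowCoeff_mul_cubic lo hi s 1 ha hb hk,
    windowCoeff_mul_quadratic lo hi s 1 hc hd, if_pos h]
  simp

end Window

theorem exists_window_isolating {e : ℕ} (he : 10 ≤ e)
    {g : MvPolynomial (SallyIdx e 1 (e - 2)) ℚ} (hg : g ∈ genSet e) :
    ∃ lo hi s, windowCoeff e 1 (e - 2) lo hi s g ≠ 0 ∧
      ∀ h ∈ genSet e, h ≠ g → ∀ f, windowCoeff e 1 (e - 2) lo hi s (f * h) = 0 := by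
  have hcube : sX e 1 (e - 2) 0 ^ 3 =
      sX e 1 (e - 2) 0 * sX e 1 (e - 2) 0 * sX e 1 (e - 2) 0 := by ring
  rcases hg with (((⟨i, j, h1, h2, h3, rfl⟩ | ⟨i, h1, h2, rfl⟩) | ⟨i, ⟨h1, h2, h3⟩, rfl⟩) |
    ⟨i, h1, rfl⟩) | rfl | rfl
  · refine ⟨i + 1, j, i + j + 1, ?_, ?_⟩
    · apply windowCoeff_quadratic_sub_ne_zero <;> omega
    · rintro _ ((((⟨i', j', k1, k2, k3, rfl⟩ | ⟨i', k1, k2, rfl⟩) | ⟨i', ⟨k1, k2, k3⟩, rfl⟩) |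
        ⟨i', k1, rfl⟩) | rfl | rfl) hne f
      · have : ¬(i' = i ∧ j' = j) := by rintro ⟨rfl, rfl⟩; exact hne rfl
        apply windowCoeff_mul_quadratic_sub_eq_zero <;> omega
      · rw [pow_two]; apply windowCoeff_mul_cubic_sub_eq_zero <;> omega
      · apply windowCoeff_mul_quadratic_sub_eq_zero <;> omega
      · apply windowCoeff_mul_quadratic_sub_eq_zero <;> omega
      · rw [hcube]; apply windowCoeff_mul_cubic_sub_eq_zero <;> omega
      · rw [pow_two]; apply windowCoeff_mul_cubic_sub_eq_zero <;> omega
  · refine ⟨0, e, e + i, ?_, ?_⟩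
    · rw [pow_two]; apply windowCoeff_cubic_sub_ne_zero <;> omega
    · rintro _ ((((⟨i', j', k1, k2, k3, rfl⟩ | ⟨i', k1, k2, rfl⟩) | ⟨i', ⟨k1, k2, k3⟩, rfl⟩) |
        ⟨i', k1, rfl⟩) | rfl | rfl) hne f
      · apply windowCoeff_mul_quadratic_sub_eq_zero <;> omega
      · have : i' ≠ i := by rintro rfl; exact hne rfl
        rw [pow_two]; apply windowCoeff_mul_cubic_sub_eq_zero <;> omega
      · apply windowCoeff_mul_quadratic_sub_eq_zero <;> omega
      · apply windowCoeff_mul_quadratic_sub_eq_zero <;> omega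
      · rw [hcube]; apply windowCoeff_mul_cubic_sub_eq_zero <;> omega
      · rw [pow_two]; apply windowCoeff_mul_cubic_sub_eq_zero <;> omega
  · refine ⟨2, e, i + 2, ?_, ?_⟩
    · apply windowCoeff_quadratic_sub_ne_zero <;> omega
    · rintro _ ((((⟨i', j', k1, k2, k3, rfl⟩ | ⟨i', k1, k2, rfl⟩) | ⟨i', ⟨k1, k2, k3⟩, rfl⟩) |
        ⟨i', k1, rfl⟩) | rfl | rfl) hne f
      · apply windowCoeff_mul_quadratic_sub_eq_zero <;> omega
      · rw [pow_two]; apply windowCoeff_mul_cubic_sub_eq_zero <;> omega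
      · have : i' ≠ i := by rintro rfl; exact hne rfl
        apply windowCoeff_mul_quadratic_sub_eq_zero <;> omega
      · apply windowCoeff_mul_quadratic_sub_eq_zero <;> omega
      · rw [hcube]; apply windowCoeff_mul_cubic_sub_eq_zero <;> omega
      · rw [pow_two]; apply windowCoeff_mul_cubic_sub_eq_zero <;> omega
  · refine ⟨2, e - 3, 2 * e - 6 - i, ?_, ?_⟩
    · apply windowCoeff_quadratic_sub_ne_zero <;> omega
    · rintro _ ((((⟨i', j', k1, k2, k3, rfl⟩ | ⟨i', k1, k2, rfl⟩) | ⟨i', ⟨k1, k2, k3⟩, rfl⟩) |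
        ⟨i', k1, rfl⟩) | rfl | rfl) hne f
      · apply windowCoeff_mul_quadratic_sub_eq_zero <;> omega
      · rw [pow_two]; apply windowCoeff_mul_cubic_sub_eq_zero <;> omega
      · apply windowCoeff_mul_quadratic_sub_eq_zero <;> omega
      · have : i' ≠ i := by rintro rfl; exact hne rfl
        apply windowCoeff_mul_quadratic_sub_eq_zero <;> omega
      · rw [hcube]; apply windowCoeff_mul_cubic_sub_eq_zero <;> omega
      · rw [pow_two]; apply windowCoeff_mul_cubic_sub_eq_zero <;> omega
  · refine ⟨0, e, e, ?_, ?_⟩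
    · rw [hcube]; apply windowCoeff_cubic_sub_ne_zero <;> omega
    · rintro _ ((((⟨i', j', k1, k2, k3, rfl⟩ | ⟨i', k1, k2, rfl⟩) | ⟨i', ⟨k1, k2, k3⟩, rfl⟩) |
        ⟨i', k1, rfl⟩) | rfl | rfl) hne f
      · apply windowCoeff_mul_quadratic_sub_eq_zero <;> omega
      · rw [pow_two]; apply windowCoeff_mul_cubic_sub_eq_zero <;> omega
      · apply windowCoeff_mul_quadratic_sub_eq_zero <;> omega
      · apply windowCoeff_mul_quadratic_sub_eq_zero <;> omega
      · exact absurd rfl hne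
      · rw [pow_two]; apply windowCoeff_mul_cubic_sub_eq_zero <;> omega
  · refine ⟨0, e, 2 * e - 2, ?_, ?_⟩
    · rw [pow_two]; apply windowCoeff_cubic_sub_ne_zero <;> omega
    · rintro _ ((((⟨i', j', k1, k2, k3, rfl⟩ | ⟨i', k1, k2, rfl⟩) | ⟨i', ⟨k1, k2, k3⟩, rfl⟩) |
        ⟨i', k1, rfl⟩) | rfl | rfl) hne f
      · apply windowCoeff_mul_quadratic_sub_eq_zero <;> omega
      · rw [pow_two]; apply windowCoeff_mul_cubic_sub_eq_zero <;> omega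
      · apply windowCoeff_mul_quadratic_sub_eq_zero <;> omega
      · apply windowCoeff_mul_quadratic_sub_eq_zero <;> omega
      · rw [hcube]; apply windowCoeff_mul_cubic_sub_eq_zero <;> omega
      · exact absurd rfl hne

theorem stmt5 (e : ℕ) (he : 10 ≤ e) :
    Ideal.span (genSet e) = sallyIdeal e 1 (e-2) ∧
    ∀ G' : Set (MvPolynomial (SallyIdx e 1 (e-2)) ℚ), G' ⊂ genSet e →
      Ideal.span G' ≠ sallyIdeal e 1 (e-2) := by
  have hspan : Ideal.span (genSet e) = sallyIdeal e 1 (e - 2) :=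
    le_antisymm (Ideal.span_le.mpr (genSet_subset_sallyIdeal he)) (sallyIdeal_le_span_genSet he)
  refine ⟨hspan, fun G' hG' hG => ?_⟩
  obtain ⟨g, hg, hgG'⟩ := Set.exists_of_ssubset hG'
  obtain ⟨lo, hi, s, hne, hzero⟩ := exists_window_isolating he hg
  refine hne (windowCoeff_eq_zero_of_mem_span lo hi s
    (fun h hh => hzero h (hG'.subset hh) fun heq => hgG' (heq ▸ hh)) ?_)
  rw [hG, ← hspan]
  exact Ideal.subset_span hg
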